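/- arXiv:1901.07146 — 2 statements merged into one kernel-verified Lean document; each statement's English description precedes it below -/
import Mathlib

section
/- Let a₁ be an ℕ-valued random variable with a₁ ≥ 1 almost surely and probability generating function g, let λ > 0, and let Δ be a nonnegative random variable with P(Δ > 0) > 0 and Laplace–Stieltjes transform L(ϑ) = E[e^{−ϑΔ}]. Suppose θ, z ∈ ℂ satisfy either (Re θ > 0 and ‖z‖ ≤ 1) or (Re θ ≥ 0 and ‖z‖ < 1). Then Re(θ + λ − λ g(z)) > 0 and ‖L(θ + λ − λ g(z))‖ < 1. -/
open MeasureTheory ProbabilityTheory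

/-- A probability generating function of a positive random variable satisfies `‖g z‖ ≤ ‖z‖`
on the closed unit disc. -/
theorem norm_integral_pow_le_norm {Ω : Type*} {mΩ : MeasurableSpace Ω} (P : Measure Ω)
    [IsProbabilityMeasure P] (a : Ω → ℕ) (ha : ∀ᵐ ω ∂P, 1 ≤ a ω) (z : ℂ) (hz : ‖z‖ ≤ 1) :
    ‖∫ ω, z ^ a ω ∂P‖ ≤ ‖z‖ := by
  have h : ∀ᵐ ω ∂P, ‖z ^ a ω‖ ≤ ‖z‖ := by
    filter_upwards [ha] with ω hω
    rw [norm_pow]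
    exact pow_le_of_le_one (norm_nonneg z) hz (by omega)
  simpa using norm_integral_le_of_norm_le_const h

/-- The Laplace–Stieltjes transform of a nonnegative random variable that is not a.s. zero has
norm less than `1` on the open right half-plane. -/
theorem norm_integral_exp_neg_mul_lt_one {Ω : Type*} {mΩ : MeasurableSpace Ω} (P : Measure Ω)
    [IsProbabilityMeasure P] (X : Ω → ℝ) (hX : Measurable X) (hX0 : ∀ ω, 0 ≤ X ω)
    (hpos : 0 < P {ω | 0 < X ω}) (s : ℂ) (hs : 0 < s.re) :
    ‖∫ ω, Complex.exp (-s * (X ω : ℂ)) ∂P‖ < 1 := by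
  have hnorm : ∀ ω, ‖Complex.exp (-s * (X ω : ℂ))‖ = Real.exp (-(s.re * X ω)) := by
    intro ω
    simp [Complex.norm_exp]
  have hle : ∀ ω, Real.exp (-(s.re * X ω)) ≤ 1 := fun ω =>
    Real.exp_le_one_iff.2 (neg_nonpos.2 (mul_nonneg hs.le (hX0 ω)))
  have hint : Integrable (fun ω => Real.exp (-(s.re * X ω))) P := by
    refine Integrable.of_bound (by fun_prop) 1 (ae_of_all _ fun ω => ?_)
    rw [Real.norm_of_nonneg (Real.exp_pos _).le]
    exact hle ω
  have hgap : 0 < ∫ ω, (1 - Real.exp (-(s.re * X ω))) ∂P := by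
    rw [integral_pos_iff_support_of_nonneg (fun ω => sub_nonneg.2 (hle ω))
      ((integrable_const 1).sub hint)]
    refine hpos.trans_le (measure_mono fun ω hω => ?_)
    have hlt : Real.exp (-(s.re * X ω)) < 1 :=
      Real.exp_lt_one_iff.2 (neg_neg_of_pos (mul_pos hs hω))
    exact (sub_pos.2 hlt).ne'
  rw [integral_sub (integrable_const 1) hint] at hgap
  calc ‖∫ ω, Complex.exp (-s * (X ω : ℂ)) ∂P‖
      ≤ ∫ ω, ‖Complex.exp (-s * (X ω : ℂ))‖ ∂P := norm_integral_le_integral_norm _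
    _ = ∫ ω, Real.exp (-(s.re * X ω)) ∂P := by simp_rw [hnorm]
    _ < 1 := by simpa using hgap

/-- If `a₁ ≥ 1` a.s. with PGF `g`, `λ > 0`, and `Δ ≥ 0` with `P(Δ > 0) > 0`
and LST `L`, then for `θ, z` with (`Re θ > 0` and `‖z‖ ≤ 1`) or (`Re θ ≥ 0` and `‖z‖ < 1`),
we have `Re(θ + λ − λ g(z)) > 0` and `‖L(θ + λ − λ g(z))‖ < 1`. -/
theorem stmt11 {Ω : Type*} {mΩ : MeasurableSpace Ω} (P : Measure Ω) [IsProbabilityMeasure P]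
    (a₁ : Ω → ℕ) (ha₁ : Measurable a₁) (ha₁ge : ∀ᵐ ω ∂P, 1 ≤ a₁ ω)
    (g : ℂ → ℂ) (hg : ∀ z : ℂ, ‖z‖ ≤ 1 → g z = ∫ ω, z ^ a₁ ω ∂P)
    (lam : ℝ) (hlam : 0 < lam)
    (Δ : Ω → ℝ) (hΔmeas : Measurable Δ) (hΔnn : ∀ ω, 0 ≤ Δ ω)
    (hΔpos : 0 < P {ω | 0 < Δ ω})
    (θ z : ℂ) (hcase : (0 < θ.re ∧ ‖z‖ ≤ 1) ∨ (0 ≤ θ.re ∧ ‖z‖ < 1)) :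
    0 < (θ + (lam : ℂ) - (lam : ℂ) * g z).re ∧
      ‖∫ ω, Complex.exp (-(θ + (lam : ℂ) - (lam : ℂ) * g z) * (Δ ω : ℂ)) ∂P‖ < 1 := by
  have hz : ‖z‖ ≤ 1 := hcase.elim (fun h => h.2) (fun h => h.2.le)
  have hgz : (g z).re ≤ ‖z‖ := by
    rw [hg z hz]
    exact (Complex.re_le_norm _).trans (norm_integral_pow_le_norm P a₁ ha₁ge z hz)
  have hre : 0 < (θ + (lam : ℂ) - (lam : ℂ) * g z).re := by
    simp only [Complex.sub_re, Complex.add_re, Complex.ofReal_re, Complex.re_ofReal_mul]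
    rcases hcase with h | h <;> nlinarith [h.1, h.2]
  exact ⟨hre, norm_integral_exp_neg_mul_lt_one P Δ hΔmeas hΔnn hΔpos _ hre⟩
end

section
/- For every θ ∈ ℂ with Re θ > 0 and every j ∈ ℕ, ∫₀^∞ e^{−θt} · b^j ∑_{k=0}^j C(j,k) (a/b)^k [ P(k, λt) + (μ/λ) P(k+1, λt) ] dt = (1/θ) · ((μ+θ+λ)/(θ+λ)) · ((bθ+λ)/(θ+λ))^j. -/
open MeasureTheory

/-- The lower regularized incomplete gamma function:
`P(k,x) = (1/(k−1)!) ∫₀^x e^{−u} u^{k−1} du` for `k ≥ 1`, and `P(0,x) = 1`. -/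
noncomputable def lowP (k : ℕ) (x : ℝ) : ℝ :=
  if k = 0 then 1
  else (1 / (Nat.factorial (k - 1) : ℝ)) * ∫ u in (0:ℝ)..x, Real.exp (-u) * u ^ (k - 1)

theorem lowP_zero (x : ℝ) : lowP 0 x = 1 := by simp [lowP]

theorem lowP_succ (k : ℕ) (x : ℝ) :
    lowP (k + 1) x = lowP k x - Real.exp (-x) * x ^ k / (k.factorial : ℝ) := by
  have hd : ∀ u : ℝ, HasDerivAt (fun u : ℝ => Real.exp (-u)) (-Real.exp (-u)) u := fun u => by
    simpa using (hasDerivAt_neg u).exp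
  rcases k with _ | k
  · have h := intervalIntegral.integral_eq_sub_of_hasDerivAt (a := 0) (b := x)
      (fun u _ => (hd u).neg) (by apply Continuous.intervalIntegrable; fun_prop)
    simp [lowP] at h ⊢
  · have h := intervalIntegral.integral_eq_sub_of_hasDerivAt (a := 0) (b := x)
      (fun u _ => (hd u).mul (hasDerivAt_pow (k + 1) u))
      (by apply Continuous.intervalIntegrable; fun_prop)
    have hs : ∀ u : ℝ, -Real.exp (-u) * u ^ (k + 1)
        + Real.exp (-u) * (((k + 1 : ℕ) : ℝ) * u ^ (k + 1 - 1))
        = ((k + 1 : ℕ) : ℝ) * (Real.exp (-u) * u ^ k) - Real.exp (-u) * u ^ (k + 1) := by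
      intro u
      rw [Nat.add_sub_cancel]
      ring
    simp_rw [hs] at h
    rw [intervalIntegral.integral_sub
      (by apply Continuous.intervalIntegrable; fun_prop)
      (by apply Continuous.intervalIntegrable; fun_prop),
      intervalIntegral.integral_const_mul] at h
    simp only [Pi.mul_apply, ne_eq, Nat.add_eq_zero_iff, one_ne_zero, and_false, not_false_eq_true,
      zero_pow, mul_zero, sub_zero] at h
    have hk : ((k + 1 : ℕ) : ℝ) ≠ 0 := by positivity
    have hf : (k.factorial : ℝ) ≠ 0 := by positivity
    simp only [lowP, Nat.add_eq_zero_iff, one_ne_zero, and_false, if_false, Nat.add_sub_cancel,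
      Nat.factorial_succ, Nat.cast_mul]
    rw [eq_sub_iff_add_eq]
    field_simp
    linear_combination -h

theorem integrableOn_pow_mul_exp_neg_mul_complex_Ioi {z : ℂ} (hz : 0 < z.re) (k : ℕ) :
    IntegrableOn (fun t : ℝ => (t : ℂ) ^ k * Complex.exp (-z * t)) (Set.Ioi 0) := by
  have h := integrableOn_rpow_mul_exp_neg_mul_rpow (p := 1) (s := k) (b := z.re)
    (by linarith [Nat.cast_nonneg (α := ℝ) k]) one_pos hz
  refine Integrable.mono' h
    (Continuous.aestronglyMeasurable (by fun_prop)) ?_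
  filter_upwards [ae_restrict_mem measurableSet_Ioi] with t ht
  have ht' : (0 : ℝ) < t := ht
  simp [Complex.norm_exp, abs_of_pos ht']

theorem tendsto_pow_mul_exp_neg_mul_complex_atTop {z : ℂ} (hz : 0 < z.re) (k : ℕ) :
    Filter.Tendsto (fun t : ℝ => (t : ℂ) ^ k * Complex.exp (-z * t)) Filter.atTop (nhds 0) := by
  rw [tendsto_zero_iff_norm_tendsto_zero]
  refine (tendsto_rpow_mul_exp_neg_mul_atTop_nhds_zero k z.re hz).congr' ?_
  filter_upwards [Filter.eventually_gt_atTop 0] with t ht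
  simp [Complex.norm_exp, abs_of_pos ht]

theorem integral_pow_mul_exp_neg_mul_complex_Ioi {z : ℂ} (hz : 0 < z.re) (k : ℕ) :
    ∫ t in Set.Ioi (0:ℝ), (t : ℂ) ^ k * Complex.exp (-z * t) = k.factorial / z ^ (k + 1) := by
  have hz0 : z ≠ 0 := by
    rintro rfl
    simp at hz
  induction k with
  | zero =>
    have := integral_exp_mul_complex_Ioi (a := -z) (by simpa using hz) 0
    simpa using this
  | succ k ih =>
    have hd : ∀ t ∈ Set.Ici (0:ℝ), HasDerivAt
        (fun t : ℝ => (t : ℂ) ^ (k + 1) * Complex.exp (-z * t))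
        (((k : ℂ) + 1) * ((t : ℂ) ^ k * Complex.exp (-z * t))
          - z * ((t : ℂ) ^ (k + 1) * Complex.exp (-z * t))) t := by
      intro t _
      have h1 := ((hasDerivAt_pow (k + 1) (t : ℂ)).mul
        (((hasDerivAt_id (t : ℂ)).const_mul (-z)).cexp)).comp_ofReal
      convert! h1 using 1
      simp
      ring
    have i1 := (integrableOn_pow_mul_exp_neg_mul_complex_Ioi hz k).const_mul ((k : ℂ) + 1)
    have i2 := (integrableOn_pow_mul_exp_neg_mul_complex_Ioi hz (k + 1)).const_mul z
    have h := integral_Ioi_of_hasDerivAt_of_tendsto' hd (i1.sub i2)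
      (tendsto_pow_mul_exp_neg_mul_complex_atTop hz (k + 1))
    rw [integral_sub i1 i2, integral_const_mul, integral_const_mul, ih] at h
    simp only [Complex.ofReal_zero, ne_eq, Nat.add_eq_zero_iff, one_ne_zero, and_false,
      not_false_eq_true, zero_pow, zero_mul, sub_zero] at h
    rw [sub_eq_zero] at h
    rw [eq_div_iff (pow_ne_zero _ hz0), pow_succ, mul_comm _ z, ← mul_assoc, mul_comm _ z, ← h,
      Nat.factorial_succ]
    push_cast
    field_simp

/-- The Laplace transform of `t ↦ P(k, λt)` is `(1/θ) (λ/(θ+λ))^k`. -/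
theorem integrableOn_and_integral_exp_mul_lowP {lam : ℝ} (hlam : 0 < lam) {θ : ℂ}
    (hθ : 0 < θ.re) (k : ℕ) :
    IntegrableOn (fun t : ℝ => Complex.exp (-θ * t) * (lowP k (lam * t) : ℂ)) (Set.Ioi 0) ∧
    ∫ t in Set.Ioi (0:ℝ), Complex.exp (-θ * t) * (lowP k (lam * t) : ℂ)
      = 1 / θ * (lam / (θ + lam)) ^ k := by
  have hz : 0 < (θ + lam).re := by simp; linarith
  have hz0 : θ + lam ≠ 0 := fun h => by simp [h] at hz
  have hθ0 : θ ≠ 0 := fun h => by simp [h] at hθ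
  induction k with
  | zero =>
    have h1 := integrableOn_pow_mul_exp_neg_mul_complex_Ioi hθ 0
    have h2 := integral_pow_mul_exp_neg_mul_complex_Ioi hθ 0
    simp only [pow_zero, one_mul, Nat.factorial_zero, Nat.cast_one, zero_add, pow_one] at h1 h2
    simp only [lowP_zero, Complex.ofReal_one, mul_one, pow_zero]
    exact ⟨h1, h2⟩
  | succ k ih =>
    have hs : ∀ t : ℝ, Complex.exp (-θ * t) * (lowP (k + 1) (lam * t) : ℂ)
        = Complex.exp (-θ * t) * (lowP k (lam * t) : ℂ)
          - (lam : ℂ) ^ k / k.factorial * ((t : ℂ) ^ k * Complex.exp (-(θ + lam) * t)) := by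
      intro t
      rw [lowP_succ, show -(θ + lam) * (t : ℂ) = -θ * t + -(lam * t) by ring, Complex.exp_add]
      push_cast
      ring
    have i2 := (integrableOn_pow_mul_exp_neg_mul_complex_Ioi hz k).const_mul
      ((lam : ℂ) ^ k / k.factorial)
    simp_rw [hs]
    refine ⟨ih.1.sub i2, ?_⟩
    rw [integral_sub ih.1 i2, integral_const_mul, ih.2,
      integral_pow_mul_exp_neg_mul_complex_Ioi hz k]
    have hf : (k.factorial : ℂ) ≠ 0 := by exact_mod_cast k.factorial_ne_zero
    rw [div_pow, div_pow]
    field_simp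
    ring

/-- For `Re θ > 0` and `j : ℕ`,
`∫₀^∞ e^{−θt} b^j ∑_{k=0}^j C(j,k)(a/b)^k [P(k,λt) + (μ/λ)P(k+1,λt)] dt
  = (1/θ)((μ+θ+λ)/(θ+λ))((bθ+λ)/(θ+λ))^j` where `b = 1 − a`. -/
theorem stmt17 (a lam μ : ℝ) (ha : 0 < a) (ha1 : a < 1) (hlam : 0 < lam) (hμ : 0 ≤ μ)
    (θ : ℂ) (hθ : 0 < θ.re) (j : ℕ) :
    ∫ t in Set.Ioi (0:ℝ), Complex.exp (-θ * (t : ℂ)) *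
        ((((1 - a) ^ j * ∑ k ∈ Finset.range (j + 1), (Nat.choose j k : ℝ) * (a / (1 - a)) ^ k *
          (lowP k (lam * t) + (μ / lam) * lowP (k + 1) (lam * t)) : ℝ)) : ℂ)
      = (1 / θ) * (((μ : ℂ) + θ + (lam : ℂ)) / (θ + (lam : ℂ))) *
          ((((1 - a : ℝ) : ℂ) * θ + (lam : ℂ)) / (θ + (lam : ℂ))) ^ j := by
  have hz : 0 < (θ + lam).re := by simp; linarith
  have hz0 : θ + lam ≠ 0 := fun h => by simp [h] at hz
  have hθ0 : θ ≠ 0 := fun h => by simp [h] at hθ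
  have hl0 : (lam : ℂ) ≠ 0 := by exact_mod_cast hlam.ne'
  have hb0 : (1 : ℂ) - a ≠ 0 := by exact_mod_cast (sub_pos.2 ha1).ne'
  have L := fun k => integrableOn_and_integral_exp_mul_lowP hlam hθ k
  have hs : ∀ t : ℝ, Complex.exp (-θ * (t : ℂ)) *
        ((((1 - a) ^ j * ∑ k ∈ Finset.range (j + 1), (Nat.choose j k : ℝ) * (a / (1 - a)) ^ k *
          (lowP k (lam * t) + (μ / lam) * lowP (k + 1) (lam * t)) : ℝ)) : ℂ)
      = ∑ k ∈ Finset.range (j + 1), ((1 - a : ℂ) ^ j * ((Nat.choose j k : ℂ) * (a / (1 - a)) ^ k)) *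
          (Complex.exp (-θ * t) * (lowP k (lam * t) : ℂ)
            + μ / lam * (Complex.exp (-θ * t) * (lowP (k + 1) (lam * t) : ℂ))) := by
    intro t
    push_cast
    rw [Finset.mul_sum, Finset.mul_sum]
    refine Finset.sum_congr rfl fun k _ => ?_
    ring
  have hi : ∀ k, IntegrableOn (fun t : ℝ => Complex.exp (-θ * t) * (lowP k (lam * t) : ℂ)
      + μ / lam * (Complex.exp (-θ * t) * (lowP (k + 1) (lam * t) : ℂ))) (Set.Ioi 0) :=
    fun k => (L k).1.add ((L (k + 1)).1.const_mul ((μ : ℂ) / lam))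
  simp_rw [hs]
  rw [integral_finsetSum _ fun k _ => (hi k).const_mul _]
  have hterm : ∀ k ∈ Finset.range (j + 1),
      ∫ t in Set.Ioi (0:ℝ), ((1 - a : ℂ) ^ j * ((Nat.choose j k : ℂ) * (a / (1 - a)) ^ k)) *
          (Complex.exp (-θ * t) * (lowP k (lam * t) : ℂ)
            + μ / lam * (Complex.exp (-θ * t) * (lowP (k + 1) (lam * t) : ℂ)))
      = (1 / θ) * ((μ + θ + lam) / (θ + lam)) *
          ((a * (lam / (θ + lam))) ^ k * (1 - a : ℂ) ^ (j - k) * (Nat.choose j k : ℂ)) := by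
    intro k hk
    have hkj : k ≤ j := Nat.lt_succ_iff.1 (Finset.mem_range.1 hk)
    rw [integral_const_mul, integral_add (L k).1 ((L (k + 1)).1.const_mul _), integral_const_mul,
      (L k).2, (L (k + 1)).2, div_pow, mul_pow, pow_succ]
    rw [show (1 - a : ℂ) ^ j = (1 - a : ℂ) ^ (j - k) * (1 - a : ℂ) ^ k by
      rw [← pow_add, Nat.sub_add_cancel hkj]]
    generalize (1 - a : ℂ) ^ (j - k) = c
    generalize ((lam : ℂ) / (θ + lam)) ^ k = d
    field_simp
    ring
  rw [Finset.sum_congr rfl hterm, ← Finset.mul_sum, ← add_pow]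
  congr 2
  push_cast
  field_simp
  ring
end
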